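/- A numerical polynomial p(t) ∈ Q[t] is the Hilbert polynomial of some homogeneous ideal in a polynomial ring over a field if and only if it admits a Gotzmann decomposition, i.e., p(t) = C(t+a_1, a_1) + C(t+a_2−1, a_2) + ... + C(t+a_r−(r−1), a_r) for some integers a_1 ≥ a_2 ≥ ... ≥ a_r ≥ 0, where C(m,k) denotes the binomial coefficient. -/

import Mathlib

open MvPolynomial Polynomial

/-- The Hilbert function of `K[x_0,…,x_n]/I` in degree `t`:
the `K`-dimension of the degree-`t` graded piece of the quotient. -/
noncomputable def hilbFun {n : ℕ} {K : Type*} [Field K]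
    (I : Ideal (MvPolynomial (Fin (n + 1)) K)) (t : ℕ) : ℕ :=
  Module.finrank K
    (↥(homogeneousSubmodule (Fin (n + 1)) K t) ⧸
      (Submodule.comap (homogeneousSubmodule (Fin (n + 1)) K t).subtype
        (I.restrictScalars K)))

/-- Homogeneous ideals, in the form used by the statement. -/
def HomId {n : ℕ} {K : Type*} [Field K] (I : Ideal (MvPolynomial (Fin (n + 1)) K)) : Prop :=
  ∀ f ∈ I, ∀ d : ℕ, homogeneousComponent d f ∈ I

/-- The degree `d` piece of an ideal, as a subspace of the polynomial ring. -/
noncomputable def pc {n : ℕ} {K : Type*} [Field K] (I : Ideal (MvPolynomial (Fin (n + 1)) K)) (d : ℕ) :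
    Submodule K (MvPolynomial (Fin (n + 1)) K) :=
  homogeneousSubmodule (Fin (n + 1)) K d ⊓ I.restrictScalars K

section basics

lemma finrank_map_inj {K V W : Type*} [Field K] [AddCommGroup V] [Module K V] [AddCommGroup W]
    [Module K W] {φ : V →ₗ[K] W} (h : Function.Injective φ) (p : Submodule K V) :
    Module.finrank K (Submodule.map φ p) = Module.finrank K p :=
  (LinearEquiv.finrank_eq (Submodule.equivMapOfInjective φ h p)).symm

variable {n : ℕ} {K : Type*} [Field K]

lemma mem_pc {I : Ideal (MvPolynomial (Fin (n + 1)) K)} {d : ℕ} {f : MvPolynomial (Fin (n + 1)) K} :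
    f ∈ pc I d ↔ f.IsHomogeneous d ∧ f ∈ I := by
  simp [pc, mem_homogeneousSubmodule]

instance finHom (d : ℕ) : Module.Finite K (homogeneousSubmodule (Fin (n + 1)) K d) :=
  Module.Finite.iff_fg.mpr (homogeneousSubmodule_fg (σ := Fin (n + 1)) (R := K) d)

instance finPc (I : Ideal (MvPolynomial (Fin (n + 1)) K)) (d : ℕ) : Module.Finite K (pc I d) :=
  Submodule.finiteDimensional_of_le (S₂ := homogeneousSubmodule (Fin (n + 1)) K d) inf_le_left

lemma hilb_add (I : Ideal (MvPolynomial (Fin (n + 1)) K)) (d : ℕ) :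
    hilbFun I d + Module.finrank K (pc I d) =
      Module.finrank K (homogeneousSubmodule (Fin (n + 1)) K d) := by
  have h := Submodule.finrank_quotient_add_finrank (Submodule.comap
    (homogeneousSubmodule (Fin (n + 1)) K d).subtype (I.restrictScalars K))
  have h2 : Module.finrank K (pc I d) = Module.finrank K (Submodule.comap
    (homogeneousSubmodule (Fin (n + 1)) K d).subtype (I.restrictScalars K)) := by
    rw [pc, ← Submodule.map_comap_subtype]
    exact finrank_map_inj (Submodule.injective_subtype _) _
  rw [h2]; exact h

lemma pc_mono {I J : Ideal (MvPolynomial (Fin (n + 1)) K)} (h : I ≤ J) (d : ℕ) :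
    pc I d ≤ pc J d := fun _ hf => mem_pc.2 ⟨(mem_pc.1 hf).1, h (mem_pc.1 hf).2⟩

lemma hilb_anti {I J : Ideal (MvPolynomial (Fin (n + 1)) K)} (h : I ≤ J) (d : ℕ) :
    hilbFun J d ≤ hilbFun I d := by
  have h1 := hilb_add I d
  have h2 := hilb_add J d
  have := Submodule.finrank_mono (pc_mono h d)
  omega

lemma pc_eq_of_hilb {I J : Ideal (MvPolynomial (Fin (n + 1)) K)} (h : I ≤ J) (d : ℕ)
    (e : hilbFun I d = hilbFun J d) : pc I d = pc J d := by
  have h1 := hilb_add I d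
  have h2 := hilb_add J d
  exact Submodule.eq_of_le_of_finrank_eq (pc_mono h d) (by omega)

lemma hilb_eq_of_pc {I J : Ideal (MvPolynomial (Fin (n + 1)) K)} (d : ℕ)
    (e : pc I d = pc J d) : hilbFun I d = hilbFun J d := by
  have h1 := hilb_add I d
  have h2 := hilb_add J d
  rw [e] at h1
  omega

lemma hilb_top (d : ℕ) : hilbFun (⊤ : Ideal (MvPolynomial (Fin (n + 1)) K)) d = 0 := by
  have h1 := hilb_add (⊤ : Ideal (MvPolynomial (Fin (n + 1)) K)) d
  have : pc (⊤ : Ideal (MvPolynomial (Fin (n + 1)) K)) d = homogeneousSubmodule (Fin (n + 1)) K d := by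
    ext f; simp [mem_pc]
  rw [this] at h1
  omega

lemma hom_mul {s r : MvPolynomial (Fin (n + 1)) K} {e d : ℕ} (hs : s.IsHomogeneous e)
    (hr : r.IsHomogeneous d) : (s * r).IsHomogeneous (d + e) := by
  have := hs.mul hr
  rwa [add_comm e d] at this

lemma comp_mul {s : MvPolynomial (Fin (n + 1)) K} {e : ℕ} (hs : s.IsHomogeneous e)
    (r : MvPolynomial (Fin (n + 1)) K) (d : ℕ) :
    homogeneousComponent (d + e) (s * r) = s * homogeneousComponent d r := by
  conv_lhs => rw [← sum_homogeneousComponent r, Finset.mul_sum, map_sum]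
  have key : ∀ i, homogeneousComponent (d + e) (s * homogeneousComponent i r) =
      if i = d then s * homogeneousComponent d r else 0 := by
    intro i
    have h1 : (s * homogeneousComponent i r) ∈ homogeneousSubmodule (Fin (n + 1)) K (i + e) := by
      rw [mem_homogeneousSubmodule]
      exact hom_mul hs (homogeneousComponent_isHomogeneous i r)
    rw [homogeneousComponent_of_mem h1]
    by_cases hi : i = d
    · subst hi; simp
    · rw [if_neg hi, if_neg (by omega)]
  simp_rw [key]
  rw [Finset.sum_ite_eq']
  split_ifs with h
  · rfl
  · rw [homogeneousComponent_eq_zero, mul_zero]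
    simpa using h

lemma comp_mul_lt {s : MvPolynomial (Fin (n + 1)) K} {e : ℕ} (hs : s.IsHomogeneous e)
    (r : MvPolynomial (Fin (n + 1)) K) (d : ℕ) (hd : d < e) :
    homogeneousComponent d (s * r) = 0 := by
  conv_lhs => rw [← sum_homogeneousComponent r, Finset.mul_sum, map_sum]
  apply Finset.sum_eq_zero
  intro i _
  have h1 : (s * homogeneousComponent i r) ∈ homogeneousSubmodule (Fin (n + 1)) K (e + i) := by
    rw [mem_homogeneousSubmodule]
    exact hs.mul (homogeneousComponent_isHomogeneous i r)
  rw [homogeneousComponent_of_mem h1, if_neg (by omega)]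

lemma comp_self {f : MvPolynomial (Fin (n + 1)) K} {d : ℕ} (hf : f.IsHomogeneous d) :
    homogeneousComponent d f = f := homogeneousComponent_eq_self hf

lemma HomId.top : HomId (⊤ : Ideal (MvPolynomial (Fin (n + 1)) K)) := fun _ _ _ => trivial

lemma HomId.sup {I J : Ideal (MvPolynomial (Fin (n + 1)) K)} (hI : HomId I) (hJ : HomId J) :
    HomId (I ⊔ J) := by
  intro f hf d
  obtain ⟨g, hg, h, hh, rfl⟩ := Submodule.mem_sup.1 hf
  rw [map_add]
  exact Submodule.add_mem_sup (hI g hg d) (hJ h hh d)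

lemma HomId.span {S : Set (MvPolynomial (Fin (n + 1)) K)}
    (hS : ∀ s ∈ S, ∃ e, s.IsHomogeneous e) : HomId (Ideal.span S) := by
  intro f hf d
  induction hf using Submodule.span_induction generalizing d with
  | mem x h =>
    obtain ⟨e, he⟩ := hS x h
    rw [homogeneousComponent_of_mem ((mem_homogeneousSubmodule _ _).2 he)]
    split_ifs
    · exact Ideal.subset_span h
    · exact zero_mem _
  | zero => simp
  | add x y _ _ hx hy => rw [map_add]; exact add_mem (hx d) (hy d)
  | smul a x hx hx' =>
    rw [smul_eq_mul, ← sum_homogeneousComponent a, Finset.sum_mul, map_sum]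
    refine Submodule.sum_mem _ fun i _ => ?_
    rcases lt_or_ge d i with h | h
    · rw [comp_mul_lt (homogeneousComponent_isHomogeneous i a) _ _ h]; exact zero_mem _
    · obtain ⟨k, rfl⟩ := Nat.exists_eq_add_of_le' h
      rw [comp_mul (homogeneousComponent_isHomogeneous i a)]
      exact Ideal.mul_mem_left _ _ (hx' k)

lemma HomId.mul {I : Ideal (MvPolynomial (Fin (n + 1)) K)} (hI : HomId I)
    {s : MvPolynomial (Fin (n + 1)) K} {e : ℕ} (hs : s.IsHomogeneous e) :
    HomId (Ideal.span {s} * I) := by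
  intro f hf d
  obtain ⟨g, hg, rfl⟩ := Ideal.mem_span_singleton_mul.1 hf
  rcases lt_or_ge d e with h | h
  · rw [comp_mul_lt hs _ _ h]; exact zero_mem _
  · obtain ⟨k, rfl⟩ := Nat.exists_eq_add_of_le' h
    rw [comp_mul hs]
    exact Ideal.mem_span_singleton_mul.2 ⟨_, hI g hg k, rfl⟩

/-- The basic exact sequence. -/
lemma hilb_exact {I J : Ideal (MvPolynomial (Fin (n + 1)) K)} (hI : HomId I)
    {l : MvPolynomial (Fin (n + 1)) K} (hl : l.IsHomogeneous 1) (hl0 : l ≠ 0)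
    (hJ : ∀ f, l * f ∈ I ↔ f ∈ J) (t : ℕ) :
    hilbFun I (t + 1) = hilbFun J t + hilbFun (I ⊔ Ideal.span {l}) (t + 1) := by
  set φ := LinearMap.mulLeft K l with hφ
  have hinj : Function.Injective φ := fun a b hab => mul_left_cancel₀ hl0 hab
  have e1 : pc (I ⊔ Ideal.span {l}) (t + 1) =
      pc I (t + 1) ⊔ Submodule.map φ (homogeneousSubmodule (Fin (n + 1)) K t) := by
    apply le_antisymm
    · intro f hf
      obtain ⟨h1, h2⟩ := mem_pc.1 hf
      obtain ⟨g, hg, u, hu, rfl⟩ := Submodule.mem_sup.1 h2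
      obtain ⟨w, rfl⟩ := Ideal.mem_span_singleton.1 hu
      have := comp_self h1
      rw [map_add, comp_mul hl] at this
      rw [← this]
      refine Submodule.add_mem_sup (mem_pc.2 ⟨homogeneousComponent_isHomogeneous _ _, hI g hg _⟩) ?_
      exact Submodule.mem_map.2 ⟨_, homogeneousComponent_mem _ _, rfl⟩
    · refine sup_le (pc_mono le_sup_left _) ?_
      rintro _ ⟨w, hw, rfl⟩
      refine mem_pc.2 ⟨?_, ?_⟩
      · exact hom_mul hl ((mem_homogeneousSubmodule _ _).1 hw)
      · exact Ideal.mem_sup_right (Ideal.mul_mem_right _ _ (Ideal.mem_span_singleton_self l))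
  have e2 : pc I (t + 1) ⊓ Submodule.map φ (homogeneousSubmodule (Fin (n + 1)) K t) =
      Submodule.map φ (pc J t) := by
    ext f
    constructor
    · rintro ⟨h1, w, hw, rfl⟩
      exact ⟨w, mem_pc.2 ⟨hw, (hJ w).1 (mem_pc.1 h1).2⟩, rfl⟩
    · rintro ⟨w, hw, rfl⟩
      obtain ⟨h1, h2⟩ := mem_pc.1 hw
      refine ⟨mem_pc.2 ⟨?_, (hJ w).2 h2⟩, w, h1, rfl⟩
      exact hom_mul hl h1
  have hd := Submodule.finrank_sup_add_finrank_inf_eq (pc I (t + 1))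
    (Submodule.map φ (homogeneousSubmodule (Fin (n + 1)) K t))
  rw [← e1, e2, finrank_map_inj hinj,
    finrank_map_inj hinj] at hd
  have h1 := hilb_add I (t + 1)
  have h2 := hilb_add J t
  have h3 := hilb_add (I ⊔ Ideal.span {l}) (t + 1)
  omega

lemma hilb_sup_zero {I : Ideal (MvPolynomial (Fin (n + 1)) K)} (hI : HomId I)
    {l : MvPolynomial (Fin (n + 1)) K} (hl : l.IsHomogeneous 1) :
    hilbFun (I ⊔ Ideal.span {l}) 0 = hilbFun I 0 := by
  apply hilb_eq_of_pc
  apply le_antisymm _ (pc_mono le_sup_left _)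
  intro f hf
  obtain ⟨h1, h2⟩ := mem_pc.1 hf
  obtain ⟨g, hg, u, hu, rfl⟩ := Submodule.mem_sup.1 h2
  obtain ⟨w, rfl⟩ := Ideal.mem_span_singleton.1 hu
  have := comp_self h1
  rw [map_add, comp_mul_lt hl _ _ (by omega), add_zero] at this
  rw [← this]
  exact mem_pc.2 ⟨homogeneousComponent_isHomogeneous _ _, hI g hg _⟩

end basics

section linear

variable {n : ℕ} {K : Type*} [Field K]

/-- The ideal generated by the first `k` variables. -/
noncomputable def Lk (n : ℕ) (K : Type*) [Field K] (k : ℕ) : Ideal (MvPolynomial (Fin (n + 1)) K) :=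
  Ideal.span (MvPolynomial.X '' {i : Fin (n + 1) | i.val < k})

lemma Lk_hom (k : ℕ) : HomId (Lk n K k) := by
  apply HomId.span
  rintro _ ⟨i, _, rfl⟩
  exact ⟨1, isHomogeneous_X K i⟩

lemma Lk_mono {k k' : ℕ} (h : k ≤ k') : Lk n K k ≤ Lk n K k' := by
  apply Ideal.span_mono
  apply Set.image_mono
  intro i hi
  exact lt_of_lt_of_le hi h

lemma Lk_mul {k : ℕ} (b : Fin (n + 1)) (hb : k ≤ b.val) (f : MvPolynomial (Fin (n + 1)) K) :
    MvPolynomial.X b * f ∈ Lk n K k ↔ f ∈ Lk n K k := by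
  refine ⟨fun h => ?_, fun h => Ideal.mul_mem_left _ _ h⟩
  rw [Lk, mem_ideal_span_X_image] at h ⊢
  intro m hm
  have h2 : m + Finsupp.single b 1 ∈ (MvPolynomial.X b * f).support := by
    rw [MvPolynomial.mem_support_iff, mul_comm, MvPolynomial.coeff_mul_X]
    exact MvPolynomial.mem_support_iff.1 hm
  obtain ⟨i, hi, hi2⟩ := h _ h2
  refine ⟨i, hi, ?_⟩
  have : b ≠ i := by
    rintro rfl
    have : b.val < k := hi
    omega
  simpa [Finsupp.single_apply, this] using hi2

lemma Lk_succ (b : Fin (n + 1)) :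
    Lk n K b.val ⊔ Ideal.span {MvPolynomial.X b} = Lk n K (b.val + 1) := by
  rw [Lk, Lk, ← Ideal.span_union]
  congr 1
  rw [← Set.image_singleton, ← Set.image_union]
  congr 1
  ext i
  simp only [Set.mem_union, Set.mem_ofPred_eq, Set.mem_singleton_iff, Fin.ext_iff]
  omega

lemma Lk_zero (k : ℕ) : hilbFun (Lk n K k) 0 = 1 := by
  have h := hilb_add (Lk n K k) 0
  have h1 : pc (Lk n K k) 0 = ⊥ := by
    rw [eq_bot_iff]
    intro f hf
    obtain ⟨h1, h2⟩ := mem_pc.1 hf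
    have h3 := comp_self h1
    rw [homogeneousComponent_zero] at h3
    rw [Submodule.mem_bot, ← h3]
    by_contra h4
    have h5 : (0 : Fin (n + 1) →₀ ℕ) ∈ f.support := by
      rw [MvPolynomial.mem_support_iff]
      intro h6
      rw [h6] at h4
      simp at h4
    rw [Lk, mem_ideal_span_X_image] at h2
    obtain ⟨i, _, hi⟩ := h2 _ h5
    simp at hi
  have h2 : homogeneousSubmodule (Fin (n + 1)) K 0 = Submodule.span K {1} := by
    rw [homogeneousSubmodule_zero, Submodule.one_eq_span]
  rw [h1, h2, finrank_bot, finrank_span_singleton one_ne_zero] at h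
  exact h

lemma mem_Lk_of_hom {t : ℕ} {f : MvPolynomial (Fin (n + 1)) K} (hf : f.IsHomogeneous (t + 1)) :
    f ∈ Lk n K (n + 1) := by
  rw [Lk, mem_ideal_span_X_image]
  intro m hm
  by_contra! hc
  have : m = 0 := by
    ext i
    exact hc i i.2
  have h3 := hf.degree_eq_sum_deg_support hm
  subst this
  simp at h3

lemma Lk_top (t : ℕ) : hilbFun (Lk n K (n + 1)) (t + 1) = 0 := by
  have h := hilb_add (Lk n K (n + 1)) (t + 1)
  have h1 : pc (Lk n K (n + 1)) (t + 1) = homogeneousSubmodule (Fin (n + 1)) K (t + 1) := by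
    apply le_antisymm inf_le_left
    intro f hf
    exact mem_pc.2 ⟨hf, mem_Lk_of_hom hf⟩
  rw [h1] at h
  omega

lemma Lk_hilb (m : ℕ) (hm : m ≤ n) (t : ℕ) : hilbFun (Lk n K (n - m)) t = (t + m).choose m := by
  have step : ∀ (b : ℕ) (hb : b ≤ n) (t : ℕ), hilbFun (Lk n K b) (t + 1) =
      hilbFun (Lk n K b) t + hilbFun (Lk n K (b + 1)) (t + 1) := by
    intro b hb t
    have := hilb_exact (Lk_hom (n := n) (K := K) b)
      (isHomogeneous_X K (⟨b, by omega⟩ : Fin (n + 1))) (MvPolynomial.X_ne_zero _)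
      (Lk_mul _ le_rfl) t
    rw [this]
    congr 2
    exact Lk_succ (⟨b, by omega⟩ : Fin (n + 1))
  induction m generalizing t with
  | zero =>
    simp only [Nat.sub_zero, Nat.choose_zero_right]
    induction t with
    | zero => exact Lk_zero _
    | succ t ih => rw [step _ le_rfl, ih, Lk_top]
  | succ m ih =>
    induction t with
    | zero => rw [Lk_zero]; simp
    | succ t iht =>
      rw [step _ (Nat.sub_le _ _), iht]
      have : n - (m + 1) + 1 = n - m := by omega
      rw [this, ih (by omega)]
      have e : t + 1 + (m + 1) = (t + 1 + m) + 1 := by omega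
      rw [e, Nat.choose_succ_succ]
      have e : t + (m + 1) = t + 1 + m := by omega
      rw [e, add_comm]

lemma exists_ideal (N : ℕ) (K : Type*) [Field K] (r : ℕ) : ∀ (a : Fin r → ℕ), Antitone a → (∀ j, a j ≤ N) →
    ∃ I : Ideal (MvPolynomial (Fin (N + 1 + 1)) K), HomId I ∧
      (∀ k, (∀ j, k ≤ N - a j) → Lk (N + 1) K k ≤ I) ∧
      ∀ t, r ≤ t → hilbFun I t = ∑ j : Fin r, (t + a j - (j : ℕ)).choose (a j) := by
  induction r with
  | zero =>
    intro a _ _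
    exact ⟨⊤, HomId.top, fun _ _ => le_top, fun t _ => by simp [hilb_top]⟩
  | succ r ih =>
    intro a ha hN
    obtain ⟨J, hJ, hL, hh⟩ := ih (fun j => a j.succ) (fun i j hij => ha (Fin.succ_le_succ_iff.2 hij))
      (fun j => hN _)
    have hbN : N - a 0 < N + 1 + 1 := by omega
    set b : Fin (N + 1 + 1) := ⟨N - a 0, hbN⟩ with hb
    have hbL : Lk (N + 1) K (N - a 0) ≤ J := hL _ fun j => by
      have := ha (Fin.zero_le j.succ)
      omega
    have hX := isHomogeneous_X K b
    have hI : HomId (Lk (N + 1) K (N - a 0) ⊔ Ideal.span {MvPolynomial.X b} * J) :=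
      (Lk_hom _).sup (hJ.mul hX)
    refine ⟨_, hI, ?_, ?_⟩
    · intro k hk
      exact (Lk_mono (hk 0)).trans le_sup_left
    · intro t ht
      obtain ⟨t, rfl⟩ : ∃ s, t = s + 1 := ⟨t - 1, by omega⟩
      rw [hilb_exact (J := J) hI hX (MvPolynomial.X_ne_zero _), hh t (by omega), Fin.sum_univ_succ, add_comm]
      · congr 1
        · have e : Lk (N + 1) K (N - a 0) ⊔ Ideal.span {MvPolynomial.X b} * J ⊔
              Ideal.span {MvPolynomial.X b} = Lk (N + 1) K (N + 1 - a 0) := by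
            rw [sup_assoc, sup_eq_right.2 (Ideal.mul_le_left (I := Ideal.span {MvPolynomial.X b}) (J := J))]
            have := Lk_succ (K := K) b
            rw [hb] at this
            simp only at this
            rw [this]
            congr 1
            have := hN 0
            omega
          rw [e, Lk_hilb _ (by have := hN 0; omega)]
          simp
        · apply Finset.sum_congr rfl
          intro j _
          congr 1
          rw [Fin.val_succ]
          omega
      · intro f
        constructor
        · intro h
          obtain ⟨s, hs, u, hu, e⟩ := Submodule.mem_sup.1 h
          obtain ⟨w, hw, rfl⟩ := Ideal.mem_span_singleton_mul.1 hu
          have : MvPolynomial.X b * (f - w) ∈ Lk (N + 1) K (N - a 0) := by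
            rw [mul_sub, ← e, add_sub_cancel_right]
            exact hs
          rw [Lk_mul b le_rfl] at this
          have := J.add_mem (hbL this) hw
          simpa using this
        · intro h
          exact Ideal.mem_sup_right (Ideal.mem_span_singleton_mul.2 ⟨f, h, rfl⟩)

end linear

section numeric

/-- Lower bound attached to a Gotzmann sequence. -/
def low (r : ℕ) (a : ℕ → ℕ) (i : ℕ) : ℕ :=
  ∑ j ∈ Finset.range r, if j ≤ i then (i - j + a j).choose (a j) else 0

lemma low_succ (r : ℕ) (a : ℕ → ℕ) (i : ℕ) :
    low r (fun j => a j + 1) (i + 1) = low r (fun j => a j + 1) i + low r a (i + 1) := by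
  unfold low
  rw [← Finset.sum_add_distrib]
  apply Finset.sum_congr rfl
  intro j _
  rcases Nat.lt_trichotomy j (i + 1) with h | h | h
  · rw [if_pos h.le, if_pos (by omega), if_pos h.le]
    have e1 : i + 1 - j + (a j + 1) = (i + 1 - j + a j) + 1 := by omega
    have e2 : i - j + (a j + 1) = i + 1 - j + a j := by omega
    rw [e1, e2, Nat.choose_succ_succ, add_comm]
  · subst h
    simp
  · rw [if_neg (by omega), if_neg (by omega), if_neg (by omega)]

lemma low_zero (r : ℕ) (a : ℕ → ℕ) :
    low r (fun j => a j + 1) 0 = low r a 0 := by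
  unfold low
  apply Finset.sum_congr rfl
  intro j _
  split_ifs with h
  · obtain rfl : j = 0 := by omega
    simp
  · rfl

lemma low_ext (r : ℕ) (a : ℕ → ℕ) (c i : ℕ) :
    low (r + c) (fun j => if j < r then a j + 1 else 0) i =
      low r (fun j => a j + 1) i + min c (i + 1 - r) := by
  induction c with
  | zero =>
    simp only [add_zero, Nat.zero_min]
    apply Finset.sum_congr rfl
    intro j hj
    have := Finset.mem_range.1 hj
    simp [this]
  | succ c ih =>
    have : low (r + (c + 1)) (fun j => if j < r then a j + 1 else 0) i =
      low (r + c) (fun j => if j < r then a j + 1 else 0) i + if r + c ≤ i then 1 else 0 := by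
      rw [low, ← add_assoc, Finset.sum_range_succ]
      simp [low]
    rw [this, ih]
    split_ifs <;> omega

lemma numeric_step (r : ℕ) (h h' l l' : ℕ → ℕ)
    (h0 : h 0 = h' 0) (hs : ∀ i, h (i + 1) = h i + h' (i + 1))
    (l0 : l 0 = l' 0) (ls : ∀ i, l (i + 1) = l i + l' (i + 1))
    (hle : ∀ i, l' i ≤ h' i)
    (hev : ∃ M, ∀ i, M ≤ i → h' i = l' i)
    (hper : ∀ i, r ≤ i → h' i = l' i → ∀ k, i ≤ k → h' k = l' k) :
    ∃ c, (∀ i, l i + min c (i + 1 - r) ≤ h i) ∧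
      (∃ M, ∀ i, M ≤ i → h i = l i + min c (i + 1 - r)) ∧
      ∀ i, r + c ≤ i → h i = l i + min c (i + 1 - r) →
        h' i = l' i ∧ ∀ k, i ≤ k → h k = l k + min c (k + 1 - r) := by
  obtain ⟨M, hM⟩ := hev
  have hl : ∀ i, l i ≤ h i := by
    intro i
    induction i with
    | zero => rw [h0, l0]; exact hle 0
    | succ i ih => rw [hs, ls]; have := hle (i + 1); omega
  -- once equal, the gap is constant
  have const : ∀ i, (∀ k, i < k → h' k = l' k) → ∀ k, i ≤ k → h k - l k = h i - l i := by
    intro i hi k hk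
    induction k, hk using Nat.le_induction with
    | base => rfl
    | succ k hk ih =>
      rw [hs, ls, hi (k + 1) (by omega)]
      omega
  have mono : ∀ i k, i ≤ k → h i - l i ≤ h k - l k := by
    intro i k hk
    induction k, hk using Nat.le_induction with
    | base => exact le_rfl
    | succ k hk ih =>
      rw [hs, ls]
      have := hle (k + 1)
      have := hl k
      omega
  obtain ⟨c, hc⟩ : ∃ c, h M - l M = c := ⟨_, rfl⟩
  have hcM : ∀ k, M ≤ k → h k - l k = c := fun k hk => by
    rw [const M (fun k hk => hM k hk.le) k hk, hc]
  have hcle : ∀ k, h k - l k ≤ c := fun k => by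
    rw [← hcM (max k M) (le_max_right _ _)]
    exact mono _ _ (le_max_left _ _)
  have bound : ∀ i, min c (i + 1 - r) ≤ h i - l i := by
    intro i
    induction i with
    | zero =>
      by_cases hr : r = 0
      · by_cases he : h' 0 = l' 0
        · have := const 0 (fun k hk => hper 0 (by omega) he k hk.le) M (Nat.zero_le _)
          omega
        · have := hle 0
          omega
      · have : 0 + 1 - r = 0 := by omega
        rw [this]; simp
    | succ i ih =>
      by_cases hr : r ≤ i + 1
      · by_cases he : h' (i + 1) = l' (i + 1)
        · have h1 := const i (fun k hk => hper (i + 1) hr he k hk) (max i M) (le_max_left _ _)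
          rw [hcM _ (le_max_right _ _)] at h1
          have := mono i (i + 1) (by omega)
          omega
        · have h1 := hle (i + 1)
          have h2 := hs i
          have h3 := ls i
          have h4 := hl i
          omega
      · have : i + 1 + 1 - r = 0 := by omega
        rw [this]; simp
  refine ⟨c, fun i => ?_, ⟨max M (r + c), fun i hi => ?_⟩, fun i hi he => ⟨?_, fun k hk => ?_⟩⟩
  · have := bound i
    have := hl i
    omega
  · have h1 := hcM i (le_trans (le_max_left _ _) hi)
    have h2 : r + c ≤ i := le_trans (le_max_right _ _) hi
    have := hl i
    omega
  · cases i with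
    | zero =>
      rw [← h0, ← l0, he]
      omega
    | succ i =>
      have h1 := bound i
      have h2 := hcle i
      have h3 := hl i
      have h4 := hs i
      have h5 := ls i
      omega
  · have h1 := bound k
    have h2 := hcle k
    have h3 := hl k
    omega

end numeric

section main

variable {n : ℕ} {K : Type*} [Field K]

/-- The inductive claim. -/
def Claim (I : Ideal (MvPolynomial (Fin (n + 1)) K)) : Prop :=
  ∃ (r : ℕ) (a : ℕ → ℕ), (∀ j k, j ≤ k → k < r → a k ≤ a j) ∧
    (∀ i, low r a i ≤ hilbFun I i) ∧
    (∃ M, ∀ i, M ≤ i → hilbFun I i = low r a i) ∧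
    ∀ i, r ≤ i → hilbFun I i = low r a i →
      ∀ k, i ≤ k → hilbFun I k = low r a k ∧ ∀ f ∈ pc I (k + 1), f ∈ Ideal.span (pc I k : Set (MvPolynomial (Fin (n + 1)) K))

lemma claim_top : Claim (⊤ : Ideal (MvPolynomial (Fin (n + 1)) K)) := by
  refine ⟨0, fun _ => 0, by simp, by simp [low], ⟨0, by simp [low, hilb_top]⟩, ?_⟩
  intro i _ _ k _
  refine ⟨by simp [low, hilb_top], ?_⟩
  intro f hf
  have hf := (mem_pc.1 hf).1
  show f ∈ Ideal.span _
  rw [f.as_sum]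
  refine Ideal.sum_mem _ fun m hm => ?_
  have hdeg := hf.degree_eq_sum_deg_support hm
  have hm0 : m ≠ 0 := by
    rintro rfl
    simp at hdeg
  obtain ⟨i, hi⟩ := Finsupp.ne_iff.1 hm0
  have hi : m i ≠ 0 := hi
  have hle : Finsupp.single i 1 ≤ m := by
    rw [Finsupp.single_le_iff]
    omega
  obtain ⟨m', rfl⟩ := exists_add_of_le hle
  have e : MvPolynomial.monomial (Finsupp.single i 1 + m') (f.coeff (Finsupp.single i 1 + m')) =
      MvPolynomial.X i * MvPolynomial.monomial m' (f.coeff (Finsupp.single i 1 + m')) := by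
    rw [MvPolynomial.X, MvPolynomial.monomial_mul, one_mul]
  rw [e]
  refine Ideal.mul_mem_left _ _ (Ideal.subset_span (mem_pc.2 ⟨?_, trivial⟩))
  apply isHomogeneous_monomial
  have h2 : (Finsupp.single i 1 + m').degree = k + 1 := hdeg.symm
  rw [map_add, Finsupp.degree_single] at h2
  omega

lemma claim_unsat {I J : Ideal (MvPolynomial (Fin (n + 1)) K)} (hIJ : I ≤ J)
    (hev : ∃ M, ∀ i, M ≤ i → hilbFun I i = hilbFun J i) (hJ : Claim J) : Claim I := by
  obtain ⟨r, a, ha, h1, ⟨M, h2⟩, h3⟩ := hJ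
  obtain ⟨M', hM'⟩ := hev
  refine ⟨r, a, ha, fun i => (h1 i).trans (hilb_anti hIJ i), ⟨max M M', fun i hi => ?_⟩, ?_⟩
  · rw [hM' i (le_trans (le_max_right _ _) hi), h2 i (le_trans (le_max_left _ _) hi)]
  · intro i hi he
    have hJi : hilbFun J i = low r a i := le_antisymm (he ▸ hilb_anti hIJ i) (h1 i)
    have h4 := h3 i hi hJi
    have h5 : ∀ k, i ≤ k → pc I k = pc J k := by
      intro k hk
      induction k, hk using Nat.le_induction with
      | base => exact pc_eq_of_hilb hIJ i (by rw [he, hJi])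
      | succ k hk ih =>
        apply le_antisymm (pc_mono hIJ _)
        intro f hf
        refine mem_pc.2 ⟨(mem_pc.1 hf).1, ?_⟩
        have := (h4 k hk).2 f hf
        rw [← ih] at this
        exact Ideal.span_le.2 (fun g hg => (mem_pc.1 hg).2) this
    intro k hk
    refine ⟨by rw [hilb_eq_of_pc k (h5 k hk)]; exact (h4 k hk).1, ?_⟩
    rw [h5 k hk, h5 (k + 1) (by omega)]
    exact (h4 k hk).2

lemma claim_nzd {I : Ideal (MvPolynomial (Fin (n + 1)) K)} (hI : HomId I)
    {l : MvPolynomial (Fin (n + 1)) K} (hl : l.IsHomogeneous 1) (hl0 : l ≠ 0)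
    (hreg : ∀ f, l * f ∈ I → f ∈ I) (hC : Claim (I ⊔ Ideal.span {l})) : Claim I := by
  obtain ⟨r, a, ha, h1, h2, h3⟩ := hC
  obtain ⟨c, c1, c2, c3⟩ := numeric_step r (hilbFun I) (hilbFun (I ⊔ Ideal.span {l}))
    (low r (fun j => a j + 1)) (low r a) (hilb_sup_zero hI hl).symm
    (hilb_exact hI hl hl0 fun f => ⟨hreg f, fun h => I.mul_mem_left _ h⟩)
    (low_zero r a) (low_succ r a) h1 h2 (fun i hi he k hk => (h3 i hi he k hk).1)
  simp_rw [← low_ext] at c1 c2 c3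
  refine ⟨r + c, _, ?_, c1, c2, ?_⟩
  · intro j k hjk hk
    split_ifs with h h'
    · have := ha j k hjk h
      omega
    · omega
    · omega
    · exact le_rfl
  · intro i hi he k hk
    obtain ⟨d1, d2⟩ := c3 i hi he
    refine ⟨d2 k hk, ?_⟩
    have h4 := (h3 i (by omega) d1 k hk).2
    intro f hf
    have hfI := mem_pc.1 hf
    have h5 := h4 f (pc_mono le_sup_left _ hf)
    have h6 : Ideal.span (pc (I ⊔ Ideal.span {l}) k : Set (MvPolynomial (Fin (n + 1)) K)) ≤
        Ideal.span (pc I k : Set (MvPolynomial (Fin (n + 1)) K)) ⊔ Ideal.span {l} := by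
      rw [Ideal.span_le]
      intro g hg
      obtain ⟨g1, g2⟩ := mem_pc.1 hg
      obtain ⟨u, hu, v, hv, rfl⟩ := Submodule.mem_sup.1 g2
      have := comp_self g1
      rw [← this, map_add]
      refine Submodule.add_mem_sup (Ideal.subset_span (mem_pc.2
        ⟨homogeneousComponent_isHomogeneous _ _, hI u hu _⟩)) ?_
      exact (HomId.span (S := {l}) (by rintro _ rfl; exact ⟨1, hl⟩)) v hv k
    obtain ⟨u, hu, v, hv, e⟩ := Submodule.mem_sup.1 (h6 h5)
    obtain ⟨w, rfl⟩ := Ideal.mem_span_singleton.1 hv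
    have e2 := comp_self hfI.1
    rw [← e, map_add, comp_mul hl, e] at e2
    have hu' := (HomId.span (S := (pc I k : Set (MvPolynomial (Fin (n + 1)) K)))
      (fun s hs => ⟨k, (mem_pc.1 hs).1⟩)) u hu (k + 1)
    have hsub : Ideal.span (pc I k : Set (MvPolynomial (Fin (n + 1)) K)) ≤ I :=
      Ideal.span_le.2 (fun g hg => (mem_pc.1 hg).2)
    have hw : homogeneousComponent k w ∈ I := by
      apply hreg
      have : l * homogeneousComponent k w = f - homogeneousComponent (k + 1) u := by
        rw [← e2]; ring
      rw [this]
      exact I.sub_mem hfI.2 (hsub hu')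
    rw [← e2]
    refine Ideal.add_mem _ hu' (Ideal.mul_mem_left _ _ (Ideal.subset_span ?_))
    exact mem_pc.2 ⟨homogeneousComponent_isHomogeneous _ _, hw⟩

end main

section induction_step

variable {n : ℕ} {K : Type*} [Field K]

lemma exists_unsat {I : Ideal (MvPolynomial (Fin (n + 1)) K)} (hI : HomId I)
    {f : MvPolynomial (Fin (n + 1)) K} (hf : f ∉ I) (hX : ∀ i, MvPolynomial.X i * f ∈ I) :
    ∃ J, I < J ∧ HomId J ∧ ∃ M, ∀ i, M ≤ i → hilbFun I i = hilbFun J i := by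
  obtain ⟨d, hd⟩ : ∃ d, homogeneousComponent d f ∉ I := by
    by_contra! hc
    apply hf
    rw [← sum_homogeneousComponent f]
    exact Ideal.sum_mem _ fun i _ => hc i
  set g := homogeneousComponent d f with hg
  have hgd : g.IsHomogeneous d := homogeneousComponent_isHomogeneous _ _
  have hgX : ∀ i, MvPolynomial.X i * g ∈ I := fun i => by
    rw [hg, ← comp_mul (isHomogeneous_X K i)]
    exact hI _ (hX i) _
  have hgL : ∀ w ∈ Lk n K (n + 1), g * w ∈ I := by
    intro w hw
    have : Lk n K (n + 1) ≤ Submodule.comap (LinearMap.mulLeft (MvPolynomial (Fin (n + 1)) K) g) I := by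
      rw [Lk, Ideal.span_le]
      rintro _ ⟨i, _, rfl⟩
      have := hgX i
      rw [mul_comm] at this
      exact this
    exact this hw
  refine ⟨I ⊔ Ideal.span {g}, ?_, hI.sup (HomId.span (by rintro _ rfl; exact ⟨d, hgd⟩)), d + 1, ?_⟩
  · refine lt_of_le_of_ne le_sup_left fun e => hd ?_
    rw [e]
    exact Ideal.mem_sup_right (Ideal.mem_span_singleton_self g)
  · intro k hk
    obtain ⟨t, rfl⟩ : ∃ t, k = (t + 1) + d := ⟨k - (d + 1), by omega⟩
    apply hilb_eq_of_pc
    apply le_antisymm (pc_mono le_sup_left _)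
    intro p hp
    obtain ⟨p1, p2⟩ := mem_pc.1 hp
    refine mem_pc.2 ⟨p1, ?_⟩
    obtain ⟨u, hu, v, hv, rfl⟩ := Submodule.mem_sup.1 p2
    obtain ⟨w, rfl⟩ := Ideal.mem_span_singleton.1 hv
    rw [← comp_self p1, map_add, comp_mul hgd]
    exact I.add_mem (hI u hu _) (hgL _ (mem_Lk_of_hom (homogeneousComponent_isHomogeneous _ _)))

lemma exists_nzd [Infinite K] {I : Ideal (MvPolynomial (Fin (n + 1)) K)}
    (hsat : ∀ f, (∀ i, MvPolynomial.X i * f ∈ I) → f ∈ I) :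
    ∃ l : MvPolynomial (Fin (n + 1)) K, l.IsHomogeneous 1 ∧ ∀ f, l * f ∈ I → f ∈ I := by
  classical
  have hfin := associatedPrimes.finite (MvPolynomial (Fin (n + 1)) K) (MvPolynomial (Fin (n + 1)) K ⧸ I)
  let V := homogeneousSubmodule (Fin (n + 1)) K 1
  let F : Ideal (MvPolynomial (Fin (n + 1)) K) → Submodule K V :=
    fun P => Submodule.comap V.subtype (P.restrictScalars K)
  have htop : ⊤ ∉ hfin.toFinset.image F := by
    intro h
    obtain ⟨P, hP, e⟩ := Finset.mem_image.1 h
    rw [Set.Finite.mem_toFinset, AssociatedPrimes.mem_iff, isAssociatedPrime_iff] at hP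
    obtain ⟨hpr, x, hx⟩ := hP
    obtain ⟨f, rfl⟩ := Ideal.Quotient.mk_surjective x
    have hmem : ∀ g, g ∈ P ↔ g * f ∈ I := by
      intro g
      rw [hx, Submodule.mem_colon_singleton, Submodule.mem_bot, ← Ideal.Quotient.eq_zero_iff_mem,
        map_mul]
      rfl
    apply hpr.ne_top
    rw [Ideal.eq_top_iff_one, hmem, one_mul]
    apply hsat
    intro i
    rw [← hmem]
    have : (⟨MvPolynomial.X i, isHomogeneous_X K i⟩ : V) ∈ F P := by rw [e]; trivial
    exact this
  have h := Subspace.biUnion_ne_univ_of_top_notMem htop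
  obtain ⟨l, hl⟩ := (Set.ne_univ_iff_exists_notMem _).1 h
  refine ⟨l.1, l.2, fun f hf => ?_⟩
  by_contra hfI
  apply hl
  have hz : l.1 ∈ ⋃ p ∈ associatedPrimes (MvPolynomial (Fin (n + 1)) K)
      (MvPolynomial (Fin (n + 1)) K ⧸ I), (p : Set (MvPolynomial (Fin (n + 1)) K)) := by
    rw [biUnion_associatedPrimes_eq_zero_divisors]
    refine ⟨Ideal.Quotient.mk I f, ?_, ?_⟩
    · rwa [Ne, Ideal.Quotient.eq_zero_iff_mem]
    · have := Ideal.Quotient.eq_zero_iff_mem.2 hf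
      rw [map_mul] at this
      exact this
  simp only [Set.mem_iUnion] at hz ⊢
  obtain ⟨P, hP, hlP⟩ := hz
  exact ⟨F P, Finset.mem_image.2 ⟨P, by simpa using hP, rfl⟩, hlP⟩

theorem claim_all [Infinite K] (I : Ideal (MvPolynomial (Fin (n + 1)) K)) (hI : HomId I) : Claim I := by
  induction I using WellFoundedGT.induction with
  | ind I ih =>
    by_cases hsat : ∀ f, (∀ i, MvPolynomial.X i * f ∈ I) → f ∈ I
    · by_cases ht : I = ⊤
      · rw [ht]; exact claim_top
      · obtain ⟨l, hl, hreg⟩ := exists_nzd hsat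
        have h1 : (1 : MvPolynomial (Fin (n + 1)) K) ∉ I := fun h => ht ((Ideal.eq_top_iff_one I).2 h)
        have hlI : l ∉ I := fun h => h1 (hreg 1 (by rwa [mul_one]))
        have hl0 : l ≠ 0 := fun h => hlI (h ▸ I.zero_mem)
        refine claim_nzd hI hl hl0 hreg (ih _ ?_ (hI.sup (HomId.span (by rintro _ rfl; exact ⟨1, hl⟩))))
        refine lt_of_le_of_ne le_sup_left fun e => hlI ?_
        rw [e]
        exact Ideal.mem_sup_right (Ideal.mem_span_singleton_self l)
    · push Not at hsat
      obtain ⟨f, hf, hfI⟩ := hsat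
      obtain ⟨J, hlt, hJ, hev⟩ := exists_unsat hI hfI hf
      exact claim_unsat hlt.le hev (ih J hlt hJ)

end induction_step

section basechange

variable {n : ℕ} {K : Type*} [Field K] {L : Type*} [Field L] [Algebra K L]

lemma finrank_hom (K : Type*) [Field K] (d : ℕ) :
    Module.finrank K (homogeneousSubmodule (Fin (n + 1)) K d) = (d + n).choose n := by
  rw [← hilb_add (Lk n K (n - n)) d, Lk_hilb n le_rfl]
  have : pc (Lk n K (n - n)) d = ⊥ := by
    rw [eq_bot_iff]
    intro f hf
    have := (mem_pc.1 hf).2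
    simpa [Lk] using this
  rw [this, finrank_bot, add_zero]

/-- The span over the bigger field. -/
noncomputable def Sp (L : Type*) [Field L] [Algebra K L]
    (W : Submodule K (MvPolynomial (Fin (n + 1)) K)) : Submodule L (MvPolynomial (Fin (n + 1)) L) :=
  Submodule.span L (MvPolynomial.map (algebraMap K L) '' (W : Set (MvPolynomial (Fin (n + 1)) K)))

lemma map_smul_alg (c : K) (x : MvPolynomial (Fin (n + 1)) K) :
    MvPolynomial.map (algebraMap K L) (c • x) = algebraMap K L c • MvPolynomial.map (algebraMap K L) x := by
  rw [MvPolynomial.smul_eq_C_mul, map_mul, MvPolynomial.map_C, MvPolynomial.smul_eq_C_mul]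

lemma Sp_le_range {W : Submodule K (MvPolynomial (Fin (n + 1)) K)} {ι : Type*}
    (b : Module.Basis ι K W) :
    Sp L W ≤ Submodule.span L (Set.range fun i => MvPolynomial.map (algebraMap K L) (b i).1) := by
  rw [Sp, Submodule.span_le]
  rintro _ ⟨w, hw, rfl⟩
  have h : (⟨w, hw⟩ : W) ∈ Submodule.span K (Set.range b) := by rw [b.span_eq]; trivial
  have key : ∀ v ∈ Submodule.span K (Set.range b), MvPolynomial.map (algebraMap K L) v.1 ∈
      Submodule.span L (Set.range fun i => MvPolynomial.map (algebraMap K L) (b i).1) := by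
    intro v hv
    induction hv using Submodule.span_induction with
    | mem x h =>
      obtain ⟨i, rfl⟩ := h
      exact Submodule.subset_span ⟨i, rfl⟩
    | zero => simp
    | add x y _ _ hx hy => simpa using add_mem hx hy
    | smul c x _ hx =>
      rw [Submodule.coe_smul, map_smul_alg]
      exact Submodule.smul_mem _ _ hx
  exact key _ h

lemma Sp_fin (W : Submodule K (MvPolynomial (Fin (n + 1)) K)) [Module.Finite K W] :
    Module.Finite L (Sp L W) ∧ Module.finrank L (Sp L W) ≤ Module.finrank K W := by
  have b := Module.finBasis K W
  have h := Sp_le_range (L := L) b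
  have hf : Module.Finite L (Submodule.span L
      (Set.range fun i => MvPolynomial.map (algebraMap K L) (b i).1)) :=
    Module.Finite.span_of_finite L (Set.finite_range _)
  refine ⟨Submodule.finiteDimensional_of_le h, (Submodule.finrank_mono h).trans ?_⟩
  refine (finrank_range_le_card _).trans ?_
  simp

lemma Sp_finrank {W : Submodule K (MvPolynomial (Fin (n + 1)) K)} {d : ℕ}
    (hW : W ≤ homogeneousSubmodule (Fin (n + 1)) K d) :
    Module.finrank L (Sp L W) = Module.finrank K W := by
  have hWf : Module.Finite K W := Submodule.finiteDimensional_of_le hW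
  apply le_antisymm (Sp_fin W).2
  obtain ⟨C0, hC0⟩ := Submodule.exists_isCompl W
  set D := C0 ⊓ homogeneousSubmodule (Fin (n + 1)) K d with hD
  have hDf : Module.Finite K D :=
    Submodule.finiteDimensional_of_le (S₂ := homogeneousSubmodule (Fin (n + 1)) K d) inf_le_right
  have hsup : W ⊔ D = homogeneousSubmodule (Fin (n + 1)) K d := by
    rw [hD, ← sup_inf_assoc_of_le _ hW, hC0.sup_eq_top, top_inf_eq]
  have hinf : W ⊓ D = ⊥ := by
    rw [eq_bot_iff, ← hC0.inf_eq_bot]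
    exact inf_le_inf_left _ inf_le_left
  have h1 := Submodule.finrank_sup_add_finrank_inf_eq W D
  rw [hsup, hinf, finrank_bot, add_zero, finrank_hom] at h1
  have i1 := (Sp_fin (L := L) W).1
  have i2 := (Sp_fin (L := L) D).1
  have hle : homogeneousSubmodule (Fin (n + 1)) L d ≤ Sp L W ⊔ Sp L D := by
    intro f hf
    rw [f.as_sum]
    refine Submodule.sum_mem _ fun m hm => ?_
    have hdeg := ((mem_homogeneousSubmodule _ _).1 hf).degree_eq_sum_deg_support hm
    have e : MvPolynomial.monomial m (f.coeff m) = f.coeff m •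
        MvPolynomial.map (algebraMap K L) (MvPolynomial.monomial m 1) := by
      rw [MvPolynomial.map_monomial, map_one, MvPolynomial.smul_monomial, smul_eq_mul, mul_one]
    rw [e]
    apply Submodule.smul_mem
    have hm2 : MvPolynomial.monomial m (1 : K) ∈ W ⊔ D := by
      rw [hsup]
      exact isHomogeneous_monomial _ hdeg.symm
    obtain ⟨w, hw, c, hc, e⟩ := Submodule.mem_sup.1 hm2
    rw [← e, map_add]
    exact Submodule.add_mem_sup (Submodule.subset_span ⟨w, hw, rfl⟩) (Submodule.subset_span ⟨c, hc, rfl⟩)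
  have h2 := Submodule.finrank_mono hle
  rw [finrank_hom] at h2
  have h3 := Submodule.finrank_sup_add_finrank_inf_eq (Sp L W) (Sp L D)
  have h4 := (Sp_fin (L := L) D).2
  omega

lemma hcomp_map (f : MvPolynomial (Fin (n + 1)) K) (d : ℕ) :
    homogeneousComponent d (MvPolynomial.map (algebraMap K L) f) =
      MvPolynomial.map (algebraMap K L) (homogeneousComponent d f) := by
  ext m
  rw [coeff_homogeneousComponent, MvPolynomial.coeff_map, MvPolynomial.coeff_map,
    coeff_homogeneousComponent]
  split_ifs <;> simp

lemma mul_Sp {I : Ideal (MvPolynomial (Fin (n + 1)) K)} {d : ℕ} (m : Fin (n + 1) →₀ ℕ) (c : L)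
    {x : MvPolynomial (Fin (n + 1)) L} (hx : x ∈ Sp L (pc I d)) :
    MvPolynomial.monomial m c * x ∈ Sp L (pc I (d + m.degree)) := by
  have e : MvPolynomial.monomial m c = c •
      MvPolynomial.map (algebraMap K L) (MvPolynomial.monomial m 1) := by
    rw [MvPolynomial.map_monomial, map_one, MvPolynomial.smul_monomial, smul_eq_mul, mul_one]
  rw [e, smul_mul_assoc]
  apply Submodule.smul_mem
  induction hx using Submodule.span_induction with
  | mem x h =>
    obtain ⟨w, hw, rfl⟩ := h
    rw [← map_mul]
    refine Submodule.subset_span ⟨_, mem_pc.2 ⟨?_, I.mul_mem_left _ (mem_pc.1 hw).2⟩, rfl⟩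
    exact hom_mul (isHomogeneous_monomial _ rfl) (mem_pc.1 hw).1
  | zero => simp
  | add x y _ _ hx hy => rw [mul_add]; exact add_mem hx hy
  | smul c x _ hx => rw [mul_smul_comm]; exact Submodule.smul_mem _ _ hx

lemma comp_mem_Sp {I : Ideal (MvPolynomial (Fin (n + 1)) K)} (hI : HomId I)
    {f : MvPolynomial (Fin (n + 1)) L} (hf : f ∈ I.map (MvPolynomial.map (algebraMap K L))) (d : ℕ) :
    homogeneousComponent d f ∈ Sp L (pc I d) := by
  rw [Ideal.map] at hf
  induction hf using Submodule.span_induction generalizing d with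
  | mem x h =>
    obtain ⟨g, hg, rfl⟩ := h
    rw [hcomp_map]
    exact Submodule.subset_span ⟨_, mem_pc.2 ⟨homogeneousComponent_isHomogeneous _ _, hI g hg d⟩, rfl⟩
  | zero => simp
  | add x y _ _ hx hy => rw [map_add]; exact add_mem (hx d) (hy d)
  | smul a x _ hx =>
    rw [smul_eq_mul, a.as_sum, Finset.sum_mul, map_sum]
    refine Submodule.sum_mem _ fun m _ => ?_
    have hm : (MvPolynomial.monomial m (a.coeff m)).IsHomogeneous m.degree := isHomogeneous_monomial _ rfl
    rcases lt_or_ge d m.degree with h | h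
    · rw [comp_mul_lt hm _ _ h]; exact zero_mem _
    · obtain ⟨k, rfl⟩ := Nat.exists_eq_add_of_le' h
      rw [comp_mul hm]
      exact mul_Sp m _ (hx k)

lemma Sp_le {I : Ideal (MvPolynomial (Fin (n + 1)) K)} (d : ℕ) :
    Sp L (pc I d) ≤ pc (I.map (MvPolynomial.map (algebraMap K L))) d := by
  rw [Sp, Submodule.span_le]
  rintro _ ⟨w, hw, rfl⟩
  exact mem_pc.2 ⟨(mem_pc.1 hw).1.map _, Ideal.mem_map_of_mem _ (mem_pc.1 hw).2⟩

lemma HomId.baseChange {I : Ideal (MvPolynomial (Fin (n + 1)) K)} (hI : HomId I) :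
    HomId (I.map (MvPolynomial.map (algebraMap K L))) :=
  fun _ hf d => (mem_pc.1 (Sp_le d (comp_mem_Sp hI hf d))).2

lemma hilb_baseChange {I : Ideal (MvPolynomial (Fin (n + 1)) K)} (hI : HomId I) (d : ℕ) :
    hilbFun (I.map (MvPolynomial.map (algebraMap K L))) d = hilbFun I d := by
  have e : pc (I.map (MvPolynomial.map (algebraMap K L))) d = Sp L (pc I d) := by
    apply le_antisymm _ (Sp_le d)
    intro f hf
    rw [← comp_self (mem_pc.1 hf).1]
    exact comp_mem_Sp hI (mem_pc.1 hf).2 d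
  have h1 := hilb_add (I.map (MvPolynomial.map (algebraMap K L))) d
  have h2 := hilb_add I d
  rw [e, Sp_finrank (W := pc I d) (d := d) inf_le_left, finrank_hom] at h1
  rw [finrank_hom] at h2
  omega

end basechange

section final

/-- The polynomial attached to a Gotzmann sequence. -/
noncomputable def gp (r : ℕ) (a : ℕ → ℕ) : Polynomial ℚ :=
  ∑ j ∈ Finset.range r, Polynomial.C (((a j).factorial : ℚ)⁻¹) *
    (descPochhammer ℚ (a j)).comp (Polynomial.X + Polynomial.C ((a j : ℚ) - (j : ℚ)))

lemma gp_eval (r : ℕ) (a : ℕ → ℕ) (t : ℕ) (ht : r ≤ t) :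
    (gp r a).eval (t : ℚ) = ∑ j ∈ Finset.range r, ((t + a j - j).choose (a j) : ℚ) := by
  rw [gp, Polynomial.eval_finsetSum]
  apply Finset.sum_congr rfl
  intro j hj
  have hj := Finset.mem_range.1 hj
  rw [Polynomial.eval_mul, Polynomial.eval_C, Polynomial.eval_comp, Polynomial.eval_add,
    Polynomial.eval_X, Polynomial.eval_C]
  have e : (t : ℚ) + ((a j : ℚ) - (j : ℚ)) = ((t + a j - j : ℕ) : ℚ) := by
    rw [Nat.cast_sub (by omega)]
    push_cast
    ring
  rw [e, descPochhammer_eval_eq_descFactorial, Nat.descFactorial_eq_factorial_mul_choose]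
  push_cast
  have := Nat.factorial_ne_zero (a j)
  field_simp

lemma low_eq (r : ℕ) (a : ℕ → ℕ) (t : ℕ) (ht : r ≤ t) :
    (low r a t : ℚ) = ∑ j ∈ Finset.range r, ((t + a j - j).choose (a j) : ℚ) := by
  rw [low]
  push_cast
  apply Finset.sum_congr rfl
  intro j hj
  have hj := Finset.mem_range.1 hj
  rw [if_pos (by omega)]
  congr 2
  omega

end final

/-- Gotzmann's representation theorem: a numerical polynomial `p(t) ∈ ℚ[t]` is the
Hilbert polynomial of some homogeneous ideal in a polynomial ring over the field `K`
if and only if it admits a Gotzmann decomposition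
`p(t) = C(t+a_1,a_1) + C(t+a_2−1,a_2) + ⋯ + C(t+a_r−(r−1),a_r)` with
`a_1 ≥ a_2 ≥ ⋯ ≥ a_r ≥ 0` (here indexed by `j = 0, …, r−1`). -/
theorem isHilbertPolynomial_iff_gotzmannDecomposition {K : Type*} [Field K]
    (p : Polynomial ℚ) (hnum : ∀ m : ℤ, ∃ k : ℤ, p.eval (m : ℚ) = (k : ℚ)) :
    (∃ (n : ℕ) (I : Ideal (MvPolynomial (Fin (n + 1)) K)), (∀ f ∈ I, ∀ d : ℕ, homogeneousComponent d f ∈ I) ∧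
        ∃ N : ℕ, ∀ s : ℕ, N ≤ s → (hilbFun I s : ℚ) = p.eval (s : ℚ)) ↔
      (∃ (r : ℕ) (a : Fin r → ℕ), Antitone a ∧
        ∀ t : ℕ, r ≤ t →
          p.eval (t : ℚ) = ∑ j : Fin r, (((t + a j - (j : ℕ)).choose (a j) : ℚ))) := by
  constructor
  · rintro ⟨n, I, hI, N, hN⟩
    have hI : HomId I := hI
    have hinf : Infinite (AlgebraicClosure K) := inferInstance
    obtain ⟨r, a, ha, -, ⟨M, hM⟩, -⟩ := claim_all _ (hI.baseChange (L := AlgebraicClosure K))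
    refine ⟨r, fun j => a j, fun i j hij => ha i j hij j.2, ?_⟩
    have hp : p = gp r a := by
      apply Polynomial.eq_of_infinite_eval_eq
      refine Set.Infinite.mono (s := (fun t : ℕ => (t : ℚ)) '' Set.Ici (max r (max M N))) ?_ ?_
      · rintro _ ⟨t, ht, rfl⟩
        have ht : max r (max M N) ≤ t := ht
        show p.eval (t : ℚ) = (gp r a).eval (t : ℚ)
        rw [← hN t (by omega), gp_eval r a t (by omega), ← low_eq r a t (by omega),
          ← hM t (by omega), hilb_baseChange hI]
      · exact (Set.Ici_infinite _).image (Nat.cast_injective.injOn)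
    intro t ht
    rw [hp, gp_eval r a t ht, Finset.sum_range]
  · rintro ⟨r, a, ha, h⟩
    obtain ⟨I, hI, -, hh⟩ := exists_ideal (∑ j, a j) K r a ha
      (fun j => Finset.single_le_sum (fun _ _ => Nat.zero_le _) (Finset.mem_univ j))
    refine ⟨_, I, hI, r, fun s hs => ?_⟩
    rw [hh s hs, h s hs]
    push_cast
    rfl
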